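/- arXiv:2603.23083 — 3 statements merged into one kernel-verified Lean document; each statement's English description precedes it below -/
import Mathlib

section
/- Let W > 0, A ≥ 0, δ > 0 and B ≤ 1 be real constants with D := (B−1)² − 4(A+δ) ≥ 0. Define μ(s) = (s+W)^{(1−B+√D)/2} for s ∈ [0, ∞). Then μ(s) > 0 and μ'(s) > 0 for all s ≥ 0, and for all functions Φ, Ψ : [0, ∞) → ℝ satisfying Φ(s) ≤ A/(s+W)² and Ψ(s) ≤ B/(s+W) for all s ≥ 0, one has Φ(s)μ(s) + Ψ(s)μ'(s) + μ''(s) ≤ −δ·μ(s)/(s+W)² < 0 for all s ≥ 0. -/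
theorem hasDerivAt_add_const_rpow {s W : ℝ} (p : ℝ) (h : 0 < s + W) :
    HasDerivAt (fun t : ℝ => (t + W) ^ p) (p * (s + W) ^ (p - 1)) s := by
  simpa using ((hasDerivAt_id s).add_const W).rpow_const (p := p) (Or.inl h.ne')

open Topology in
theorem deriv_deriv_add_const_rpow {s W : ℝ} (p : ℝ) (h : 0 < s + W) :
    deriv (deriv fun t : ℝ => (t + W) ^ p) s = p * ((p - 1) * (s + W) ^ (p - 1 - 1)) := by
  have hev : deriv (fun t : ℝ => (t + W) ^ p) =ᶠ[𝓝 s] fun t => p * (t + W) ^ (p - 1) := by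
    filter_upwards [(continuous_id.add continuous_const).continuousAt.eventually (lt_mem_nhds h)]
      with t ht using (hasDerivAt_add_const_rpow p ht).deriv
  rw [hev.deriv_eq]
  exact ((hasDerivAt_add_const_rpow (p - 1) h).const_mul p).deriv

/-- Increasing power test function (case B ≤ 1, nonnegative discriminant):
μ(s) = (s+W)^{(1−B+√D)/2} is positive and increasing on [0,∞), and for all
Φ ≤ A/(s+W)², Ψ ≤ B/(s+W) one has Φμ + Ψμ' + μ'' ≤ −δμ/(s+W)² < 0. -/
theorem test_function_power_increasing
    (W A δ B : ℝ) (hW : 0 < W) (hA : 0 ≤ A) (hδ : 0 < δ) (hB : B ≤ 1)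
    (hD : 0 ≤ (B - 1) ^ 2 - 4 * (A + δ))
    (μ : ℝ → ℝ)
    (hμ : μ = fun s : ℝ =>
      (s + W) ^ ((1 - B + Real.sqrt ((B - 1) ^ 2 - 4 * (A + δ))) / 2)) :
    (∀ s : ℝ, 0 ≤ s → 0 < μ s ∧ 0 < deriv μ s) ∧
    (∀ Φ Ψ : ℝ → ℝ,
      (∀ s : ℝ, 0 ≤ s → Φ s ≤ A / (s + W) ^ 2) →
      (∀ s : ℝ, 0 ≤ s → Ψ s ≤ B / (s + W)) →
      ∀ s : ℝ, 0 ≤ s →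
        Φ s * μ s + Ψ s * deriv μ s + deriv (deriv μ) s ≤ -δ * μ s / (s + W) ^ 2 ∧
        -δ * μ s / (s + W) ^ 2 < 0) := by
  set p := (1 - B + Real.sqrt ((B - 1) ^ 2 - 4 * (A + δ))) / 2 with hp_def
  have hB' : B < 1 := lt_of_le_of_ne hB fun h => by
    rw [h] at hD
    linarith
  have hp : 0 < p := by
    have := Real.sqrt_nonneg ((B - 1) ^ 2 - 4 * (A + δ))
    rw [hp_def]
    linarith
  have hroot : A + B * p + p * (p - 1) = -δ := by
    have hsq : (2 * p - (1 - B)) ^ 2 = (B - 1) ^ 2 - 4 * (A + δ) := by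
      rw [← Real.sq_sqrt hD, hp_def]
      ring
    linarith
  have hμ_pos : ∀ s : ℝ, 0 ≤ s → 0 < μ s := fun s hs => by
    rw [hμ]
    exact Real.rpow_pos_of_pos (by linarith) p
  have hderiv : ∀ s : ℝ, 0 ≤ s → deriv μ s = p * μ s / (s + W) := fun s hs => by
    have hx : 0 < s + W := by linarith
    rw [hμ, (hasDerivAt_add_const_rpow p hx).deriv, Real.rpow_sub_one hx.ne']
    ring
  have hderiv_pos : ∀ s : ℝ, 0 ≤ s → 0 < deriv μ s := fun s hs => by
    have := hμ_pos s hs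
    rw [hderiv s hs]
    positivity
  refine ⟨fun s hs => ⟨hμ_pos s hs, hderiv_pos s hs⟩, fun Φ Ψ hΦ hΨ s hs => ?_⟩
  have hx : 0 < s + W := by linarith
  have hm := hμ_pos s hs
  have hderiv2 : deriv (deriv μ) s = p * (p - 1) * μ s / (s + W) ^ 2 := by
    rw [hμ, deriv_deriv_add_const_rpow p hx, Real.rpow_sub_one hx.ne', Real.rpow_sub_one hx.ne']
    field_simp
  constructor
  · calc Φ s * μ s + Ψ s * deriv μ s + deriv (deriv μ) s
        ≤ A / (s + W) ^ 2 * μ s + B / (s + W) * deriv μ s + deriv (deriv μ) s := by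
          gcongr
          · exact hΦ s hs
          · exact (hderiv_pos s hs).le
          · exact hΨ s hs
      _ = -δ * μ s / (s + W) ^ 2 := by
          rw [hderiv s hs, hderiv2, ← hroot]
          field_simp
  · exact div_neg_of_neg_of_pos (mul_neg_of_neg_of_pos (neg_neg_of_pos hδ) hm) (by positivity)
end

section
/- Let W > 0, A ≥ 0, δ > 0 and B ≤ 1 be real constants with D := (B−1)² − 4(A+δ) < 0, and let η ∈ (0, π/2). Set b = W·(e^{(π−2η)/√(−D)} − 1) and define μ(s) = (s+W)^{(1−B)/2} · sin( (√(−D)/2)·log(s/W + 1) + η ) for s ∈ [0, b). Then μ(s) > 0 and μ'(s) > 0 for all s ∈ [0, b), and for all functions Φ, Ψ : [0, b) → ℝ satisfying Φ(s) ≤ A/(s+W)² and Ψ(s) ≤ B/(s+W) for all s ∈ [0, b), one has Φ(s)μ(s) + Ψ(s)μ'(s) + μ''(s) ≤ −δ·μ(s)/(s+W)² < 0 for all s ∈ [0, b). -/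
/-- Derivative of a general real oscillatory Euler–Cauchy function. -/
theorem hasDerivAt_rpow_mul_sin_add_cos (W p k η a c : ℝ) (hW : 0 < W) {s : ℝ} (hs : 0 < s + W) :
    HasDerivAt (fun s : ℝ => (s + W) ^ p *
        (a * Real.sin (k * Real.log (s / W + 1) + η) + c * Real.cos (k * Real.log (s / W + 1) + η)))
      ((s + W) ^ (p - 1) *
        ((p * a - k * c) * Real.sin (k * Real.log (s / W + 1) + η) +
          (p * c + k * a) * Real.cos (k * Real.log (s / W + 1) + η))) s := by
  have hsW : s / W + 1 = (s + W) / W := by field_simp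
  have hpos : 0 < s / W + 1 := by rw [hsW]; positivity
  have hpow : HasDerivAt (fun s : ℝ => (s + W) ^ p) (1 * p * (s + W) ^ (p - 1)) s :=
    ((hasDerivAt_id s).add_const W).rpow_const (Or.inl hs.ne')
  have hphase : HasDerivAt (fun s : ℝ => k * Real.log (s / W + 1) + η) (k / (s + W)) s := by
    have h := (((((hasDerivAt_id s).div_const W).add_const 1).log hpos.ne').const_mul k).add_const η
    refine h.congr_deriv ?_
    simp only [id_eq, hsW]
    field_simp
  refine (hpow.mul ((hphase.sin.const_mul a).add (hphase.cos.const_mul c))).congr_deriv ?_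
  have hsplit : (s + W) ^ p = (s + W) ^ (p - 1) * (s + W) := by
    rw [Real.rpow_sub_one hs.ne']; field_simp
  simp only [hsplit, Pi.add_apply]
  field_simp
  ring

/-- On `[0, W (e^{(π - 2η) / r} - 1))` the phase stays in `[η, π / 2)`. -/
theorem phase_mem_Ico {W r η s : ℝ} (hW : 0 < W) (hr : 0 < r)
    (hs : s ∈ Set.Ico 0 (W * (Real.exp ((Real.pi - 2 * η) / r) - 1))) :
    r / 2 * Real.log (s / W + 1) + η ∈ Set.Ico η (Real.pi / 2) := by
  obtain ⟨hs0, hsb⟩ := hs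
  have hsW : 0 ≤ s / W := by positivity
  have hlog0 : 0 ≤ Real.log (s / W + 1) := Real.log_nonneg (by linarith)
  have hlog : Real.log (s / W + 1) < (Real.pi - 2 * η) / r := by
    rw [Real.log_lt_iff_lt_exp (by linarith)]
    have : s / W < Real.exp ((Real.pi - 2 * η) / r) - 1 := by
      rw [div_lt_iff₀ hW]; linarith
    linarith
  rw [lt_div_iff₀ hr] at hlog
  exact ⟨by nlinarith [mul_nonneg hr.le hlog0], by linarith⟩

/-- Oscillatory test function (case B ≤ 1, negative discriminant):
on [0, b) with b = W(e^{(π−2η)/√(−D)} − 1), the sine-type Euler–Cauchy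
solution μ is positive and increasing, and for all Φ ≤ A/(s+W)²,
Ψ ≤ B/(s+W) one has Φμ + Ψμ' + μ'' ≤ −δμ/(s+W)² < 0. -/
theorem test_function_oscillatory_increasing
    (W A δ B η : ℝ) (hW : 0 < W) (hA : 0 ≤ A) (hδ : 0 < δ) (hB : B ≤ 1)
    (hD : (B - 1) ^ 2 - 4 * (A + δ) < 0)
    (hη : η ∈ Set.Ioo 0 (Real.pi / 2))
    (b : ℝ)
    (hb : b = W * (Real.exp ((Real.pi - 2 * η) /
      Real.sqrt (-((B - 1) ^ 2 - 4 * (A + δ)))) - 1))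
    (μ : ℝ → ℝ)
    (hμ : μ = fun s : ℝ => (s + W) ^ ((1 - B) / 2) *
      Real.sin (Real.sqrt (-((B - 1) ^ 2 - 4 * (A + δ))) / 2 *
        Real.log (s / W + 1) + η)) :
    (∀ s : ℝ, s ∈ Set.Ico 0 b → 0 < μ s ∧ 0 < deriv μ s) ∧
    (∀ Φ Ψ : ℝ → ℝ,
      (∀ s : ℝ, s ∈ Set.Ico 0 b → Φ s ≤ A / (s + W) ^ 2) →
      (∀ s : ℝ, s ∈ Set.Ico 0 b → Ψ s ≤ B / (s + W)) →
      ∀ s : ℝ, s ∈ Set.Ico 0 b →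
        Φ s * μ s + Ψ s * deriv μ s + deriv (deriv μ) s ≤ -δ * μ s / (s + W) ^ 2 ∧
        -δ * μ s / (s + W) ^ 2 < 0) := by
  set r := Real.sqrt (-((B - 1) ^ 2 - 4 * (A + δ)))
  have hr : 0 < r := Real.sqrt_pos.mpr (by linarith)
  have hrsq : r ^ 2 = -((B - 1) ^ 2 - 4 * (A + δ)) := Real.sq_sqrt (by linarith)
  set p := (1 - B) / 2 with hp_def
  have hp : 0 ≤ p := by rw [hp_def]; linarith
  have hBp : B = 1 - 2 * p := by rw [hp_def]; ring
  have hd1 : ∀ s : ℝ, 0 < s + W → deriv μ s = (s + W) ^ (p - 1) *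
      (p * Real.sin (r / 2 * Real.log (s / W + 1) + η) +
        r / 2 * Real.cos (r / 2 * Real.log (s / W + 1) + η)) := by
    intro s hs
    have h := (hasDerivAt_rpow_mul_sin_add_cos W p (r / 2) η 1 0 hW hs).deriv
    simpa [hμ] using h
  have hd2 : ∀ s : ℝ, 0 < s + W → deriv (deriv μ) s = (s + W) ^ (p - 1 - 1) *
      (((p - 1) * p - r / 2 * (r / 2)) * Real.sin (r / 2 * Real.log (s / W + 1) + η) +
        ((p - 1) * (r / 2) + r / 2 * p) *
          Real.cos (r / 2 * Real.log (s / W + 1) + η)) := by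
    intro s hs
    refine ((hasDerivAt_rpow_mul_sin_add_cos W (p - 1) (r / 2) η p (r / 2) hW
      hs).congr_of_eventuallyEq ?_).deriv
    filter_upwards [lt_mem_nhds (show -W < s by linarith)] with t ht
    exact hd1 t (by linarith)
  have hpos : ∀ s : ℝ, s ∈ Set.Ico 0 b → 0 < μ s ∧ 0 < deriv μ s := by
    intro s hs
    have hsW : 0 < s + W := by linarith [hs.1]
    obtain ⟨hl, hu⟩ := phase_mem_Ico hW hr (hb ▸ hs)
    have hsin := Real.sin_pos_of_pos_of_lt_pi (hη.1.trans_le hl) (by linarith [Real.pi_pos])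
    have hcos := Real.cos_pos_of_mem_Ioo ⟨by linarith [hη.1, Real.pi_pos], hu⟩
    rw [hd1 s hsW, hμ]
    constructor <;> positivity
  refine ⟨hpos, fun Φ Ψ hΦ hΨ s hs => ?_⟩
  have hsW : 0 < s + W := by linarith [hs.1]
  obtain ⟨hμ0, hμ1⟩ := hpos s hs
  have hode : A / (s + W) ^ 2 * μ s + B / (s + W) * deriv μ s + deriv (deriv μ) s =
      -δ * μ s / (s + W) ^ 2 := by
    have hA' : A = p ^ 2 + (r / 2) ^ 2 - δ := by rw [hp_def]; linear_combination -hrsq / 4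
    rw [hd2 s hsW, hd1 s hsW, hμ, Real.rpow_sub_one hsW.ne' (p - 1), Real.rpow_sub_one hsW.ne' p]
    clear_value p r
    subst hA' hBp
    field_simp
    ring
  constructor
  · rw [← hode]
    gcongr
    · exact hΦ s hs
    · exact hΨ s hs
  · rw [neg_mul, neg_div, neg_lt_zero]
    positivity
end

section
/- Let W > 0, A ≥ 0, δ > 0 and B ≥ 1 be real constants with D := (B−1)² − 4(A+δ) < 0, and let η ∈ (0, π/2). Set b = W·(e^{(π−2η)/√(−D)} − 1) and define μ(s) = (s+W)^{(1−B)/2} · cos( (√(−D)/2)·log(s/W + 1) + η ) for s ∈ [0, b). Then μ(s) > 0 and μ'(s) < 0 for all s ∈ [0, b), and for all functions Φ, Ψ : [0, b) → ℝ satisfying Φ(s) ≤ A/(s+W)² and Ψ(s) ≥ B/(s+W) for all s ∈ [0, b), one has Φ(s)μ(s) + Ψ(s)μ'(s) + μ''(s) ≤ −δ·μ(s)/(s+W)² < 0 for all s ∈ [0, b). -/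
/-- The functions `(s + W) ^ p * (α cos θ + β sin θ)` with phase `θ = k log (s / W + 1) + η` are
closed under differentiation, up to lowering the exponent by one. -/
theorem hasDerivAt_rpow_mul_cos_add_sin_log {W : ℝ} (hW : 0 < W) (p k η α β : ℝ) {s : ℝ}
    (hs : 0 < s + W) :
    HasDerivAt (fun s : ℝ => (s + W) ^ p *
        (α * Real.cos (k * Real.log (s / W + 1) + η) +
          β * Real.sin (k * Real.log (s / W + 1) + η)))
      ((s + W) ^ (p - 1) *
        ((p * α + k * β) * Real.cos (k * Real.log (s / W + 1) + η) +
          (p * β - k * α) * Real.sin (k * Real.log (s / W + 1) + η))) s := by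
  have hphase_pos : s / W + 1 ≠ 0 := by
    have : s / W + 1 = (s + W) / W := by field_simp
    rw [this]
    positivity
  have hθ : HasDerivAt (fun s : ℝ => k * Real.log (s / W + 1) + η) (k / (s + W)) s := by
    have h := (((((hasDerivAt_id s).div_const W).add_const 1).log hphase_pos).const_mul k).add_const η
    refine h.congr_deriv ?_
    simp only [id]
    field_simp
  have hpow : HasDerivAt (fun s : ℝ => (s + W) ^ p) (p * (s + W) ^ (p - 1)) s := by
    simpa using ((hasDerivAt_id s).add_const W).rpow_const (p := p) (Or.inl hs.ne')
  refine (hpow.mul ((hθ.cos.const_mul α).add (hθ.sin.const_mul β))).congr_deriv ?_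
  have hsplit : (s + W) ^ p = (s + W) ^ (p - 1) * (s + W) := by
    rw [Real.rpow_sub_one hs.ne', div_mul_cancel₀ _ hs.ne']
  simp only [Pi.add_apply, hsplit]
  field_simp
  ring


/-- Oscillatory cosine test function (case B ≥ 1, negative discriminant):
on [0, b) with b = W(e^{(π−2η)/√(−D)} − 1), the cosine-type Euler–Cauchy
solution μ is positive and decreasing, and for all Φ ≤ A/(s+W)²,
Ψ ≥ B/(s+W) one has Φμ + Ψμ' + μ'' ≤ −δμ/(s+W)² < 0. -/
theorem test_function_oscillatory_decreasing
    (W A δ B η : ℝ) (hW : 0 < W) (hA : 0 ≤ A) (hδ : 0 < δ) (hB : 1 ≤ B)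
    (hD : (B - 1) ^ 2 - 4 * (A + δ) < 0)
    (hη : η ∈ Set.Ioo 0 (Real.pi / 2))
    (b : ℝ)
    (hb : b = W * (Real.exp ((Real.pi - 2 * η) /
      Real.sqrt (-((B - 1) ^ 2 - 4 * (A + δ)))) - 1))
    (μ : ℝ → ℝ)
    (hμ : μ = fun s : ℝ => (s + W) ^ ((1 - B) / 2) *
      Real.cos (Real.sqrt (-((B - 1) ^ 2 - 4 * (A + δ))) / 2 *
        Real.log (s / W + 1) + η)) :
    (∀ s : ℝ, s ∈ Set.Ico 0 b → 0 < μ s ∧ deriv μ s < 0) ∧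
    (∀ Φ Ψ : ℝ → ℝ,
      (∀ s : ℝ, s ∈ Set.Ico 0 b → Φ s ≤ A / (s + W) ^ 2) →
      (∀ s : ℝ, s ∈ Set.Ico 0 b → B / (s + W) ≤ Ψ s) →
      ∀ s : ℝ, s ∈ Set.Ico 0 b →
        Φ s * μ s + Ψ s * deriv μ s + deriv (deriv μ) s ≤ -δ * μ s / (s + W) ^ 2 ∧
        -δ * μ s / (s + W) ^ 2 < 0) := by
  obtain ⟨hη0, hη1⟩ := hη
  have hk2 : Real.sqrt (-((B - 1) ^ 2 - 4 * (A + δ))) ^ 2 = -((B - 1) ^ 2 - 4 * (A + δ)) :=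
    Real.sq_sqrt (by linarith)
  have hk0 : 0 < Real.sqrt (-((B - 1) ^ 2 - 4 * (A + δ))) := Real.sqrt_pos.2 (by linarith)
  generalize Real.sqrt (-((B - 1) ^ 2 - 4 * (A + δ))) = r at *
  let θ : ℝ → ℝ := fun s => r / 2 * Real.log (s / W + 1) + η
  have hd1 : ∀ s, 0 < s + W → deriv μ s = (s + W) ^ ((1 - B) / 2 - 1) *
      ((1 - B) / 2 * Real.cos (θ s) + -(r / 2) * Real.sin (θ s)) := by
    intro s hs
    have h := hasDerivAt_rpow_mul_cos_add_sin_log hW ((1 - B) / 2) (r / 2) η 1 0 hs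
    simpa [hμ, θ] using h.deriv
  have hd2 : ∀ s, 0 < s + W → deriv (deriv μ) s = (s + W) ^ ((1 - B) / 2 - 1 - 1) *
      ((((1 - B) / 2 - 1) * ((1 - B) / 2) + r / 2 * -(r / 2)) * Real.cos (θ s) +
        (((1 - B) / 2 - 1) * -(r / 2) - r / 2 * ((1 - B) / 2)) * Real.sin (θ s)) := by
    intro s hs
    have hev : ∀ᶠ t in nhds s, 0 < t + W :=
      (continuous_id.add continuous_const).continuousAt.eventually_const_lt hs
    have heq := hev.mono fun t ht => hd1 t ht
    rw [Filter.EventuallyEq.deriv_eq heq]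
    exact (hasDerivAt_rpow_mul_cos_add_sin_log hW _ (r / 2) η _ _ hs).deriv
  have hθ : ∀ s ∈ Set.Ico 0 b, 0 < θ s ∧ θ s < Real.pi / 2 := by
    rintro s ⟨hs0, hsb⟩
    have hsW : 0 ≤ s / W := by positivity
    have hlog0 : 0 ≤ Real.log (s / W + 1) := Real.log_nonneg (by linarith)
    have hlog1 : Real.log (s / W + 1) < (Real.pi - 2 * η) / r := by
      rw [Real.log_lt_iff_lt_exp (by linarith), ← lt_sub_iff_add_lt, div_lt_iff₀ hW]
      linarith
    rw [lt_div_iff₀ hk0] at hlog1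
    constructor
    · have : 0 ≤ r / 2 * Real.log (s / W + 1) := by positivity
      simp only [θ]
      linarith
    · simp only [θ]
      linarith
  have hcos : ∀ s ∈ Set.Ico 0 b, 0 < Real.cos (θ s) := fun s hs =>
    Real.cos_pos_of_mem_Ioo ⟨by linarith [(hθ s hs).1, Real.pi_pos], (hθ s hs).2⟩
  have hsin : ∀ s ∈ Set.Ico 0 b, 0 < Real.sin (θ s) := fun s hs =>
    Real.sin_pos_of_pos_of_lt_pi (hθ s hs).1 (by linarith [(hθ s hs).2, Real.pi_pos])
  have hx : ∀ s ∈ Set.Ico 0 b, 0 < s + W := fun s hs => add_pos_of_nonneg_of_pos hs.1 hW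
  have hμs : ∀ s, μ s = (s + W) ^ ((1 - B) / 2) * Real.cos (θ s) := fun s => by rw [hμ]
  have hmain : ∀ s ∈ Set.Ico 0 b, 0 < μ s ∧ deriv μ s < 0 := by
    intro s hs
    have hc := hcos s hs
    have hx := hx s hs
    refine ⟨by rw [hμs]; positivity, ?_⟩
    rw [hd1 s hx]
    refine mul_neg_of_pos_of_neg (by positivity) ?_
    have h1 : 0 ≤ (B - 1) / 2 * Real.cos (θ s) := mul_nonneg (by linarith) hc.le
    have h2 : 0 < r / 2 * Real.sin (θ s) := mul_pos (by linarith) (hsin s hs)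
    linarith
  refine ⟨hmain, fun Φ Ψ hΦ hΨ s hs => ?_⟩
  obtain ⟨hpos, hneg⟩ := hmain s hs
  have hx := hx s hs
  have hode : A / (s + W) ^ 2 * μ s + B / (s + W) * deriv μ s + deriv (deriv μ) s =
      -δ * μ s / (s + W) ^ 2 := by
    rw [hd2 s hx, hd1 s hx, hμs, Real.rpow_sub_one hx.ne' ((1 - B) / 2 - 1),
      Real.rpow_sub_one hx.ne']
    field_simp
    linear_combination (-(Real.cos (θ s))) * hk2
  constructor
  · have h1 := mul_le_mul_of_nonneg_right (hΦ s hs) hpos.le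
    have h2 := mul_le_mul_of_nonpos_right (hΨ s hs) hneg.le
    linarith
  · have : 0 < δ * μ s / (s + W) ^ 2 := by positivity
    rw [neg_mul, neg_div]
    linarith
end
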